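/- Let r > 0 and N ≥ 1, and define φ : ℝ → ℝ by φ(x) = ∑_{i=0}^{N−1} g_i(x), where g_i(x) = (−1)^i √(r² − (x − (2i+1)r)²) for x ∈ [2ir, 2(i+1)r] and g_i(x) = 0 otherwise. Then for every integer i with 0 ≤ i ≤ N, φ is not differentiable at the point x = 2ir; in particular the geodesic fails to be differentiable at each simple contact of two consecutive balls. -/

import Mathlib

/-- The `i`-th semicircular piece of the geodesic profile: `g_i(x) =
(−1)^i √(r² − (x − (2i+1)r)²)` for `x ∈ [2ir, 2(i+1)r]`, and `0` otherwise. -/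
noncomputable def geodesicPiece (r : ℝ) (i : ℕ) (x : ℝ) : ℝ :=
  if x ∈ Set.Icc (2 * (i : ℝ) * r) (2 * ((i : ℝ) + 1) * r) then
    (-1) ^ i * Real.sqrt (r ^ 2 - (x - (2 * (i : ℝ) + 1) * r) ^ 2)
  else 0

/-- The geodesic profile function for `N` aligned tangent balls of radius `r`:
`φ(x) = ∑_{i=0}^{N−1} g_i(x)`. -/
noncomputable def geodesicProfile (r : ℝ) (N : ℕ) (x : ℝ) : ℝ :=
  ∑ i ∈ Finset.range N, geodesicPiece r i x

/-- Since `Real.sqrt` vanishes on negative numbers, the cut-off in `geodesicPiece` is redundant. -/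
theorem geodesicPiece_eq_sqrt {r : ℝ} (hr : 0 < r) (i : ℕ) (x : ℝ) :
    geodesicPiece r i x = (-1) ^ i * Real.sqrt (r ^ 2 - (x - (2 * (i : ℝ) + 1) * r) ^ 2) := by
  unfold geodesicPiece
  split_ifs with h
  · rfl
  · rw [Real.sqrt_eq_zero_of_nonpos, mul_zero]
    by_contra! hpos
    obtain ⟨h₁, h₂⟩ := abs_lt_of_sq_lt_sq' (sub_pos.mp hpos) hr.le
    exact h ⟨by linarith, by linarith⟩

/-- The square of the geodesic profile is a quadratic polynomial over each ball. -/
theorem geodesicProfile_sq {r : ℝ} (hr : 0 < r) {N j : ℕ} (hj : j < N) {x : ℝ}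
    (hx : x ∈ Set.Icc (2 * (j : ℝ) * r) (2 * ((j : ℝ) + 1) * r)) :
    geodesicProfile r N x ^ 2 = r ^ 2 - (x - (2 * (j : ℝ) + 1) * r) ^ 2 := by
  obtain ⟨hx₁, hx₂⟩ := hx
  unfold geodesicProfile
  rw [Finset.sum_eq_single_of_mem j (Finset.mem_range.mpr hj), geodesicPiece_eq_sqrt hr,
    mul_pow, ← pow_mul, mul_comm j, pow_mul, neg_one_sq, one_pow, one_mul, Real.sq_sqrt]
  · nlinarith
  · intro i _ hij
    rw [geodesicPiece_eq_sqrt hr, Real.sqrt_eq_zero_of_nonpos, mul_zero]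
    rcases Nat.lt_or_gt_of_ne hij with h | h
    · have h' : ((i : ℝ) + 1) * r ≤ j * r :=
        mul_le_mul_of_nonneg_right (by exact_mod_cast h) hr.le
      nlinarith
    · have h' : ((j : ℝ) + 1) * r ≤ i * r :=
        mul_le_mul_of_nonneg_right (by exact_mod_cast h) hr.le
      nlinarith

/-- The geodesic profile is not differentiable where it vanishes on the axis of a ball: its square
would have derivative zero there. -/
theorem not_differentiableAt_geodesicProfile {r : ℝ} (hr : 0 < r) {N j : ℕ} (hj : j < N) {c : ℝ}
    (hc : c ∈ Set.Icc (2 * (j : ℝ) * r) (2 * ((j : ℝ) + 1) * r))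
    (hc' : (c - (2 * (j : ℝ) + 1) * r) ^ 2 = r ^ 2) :
    ¬ DifferentiableAt ℝ (geodesicProfile r N) c := by
  intro hd
  have hzero : geodesicProfile r N c = 0 := by
    rw [← sq_eq_zero_iff, geodesicProfile_sq hr hj hc, hc', sub_self]
  have hsq := (hd.hasDerivAt.fun_pow 2).hasDerivWithinAt
    (s := Set.Icc (2 * (j : ℝ) * r) (2 * ((j : ℝ) + 1) * r))
  have hpoly := (((((hasDerivAt_id c).sub_const ((2 * (j : ℝ) + 1) * r)).fun_pow 2).const_sub
    (r ^ 2)).hasDerivWithinAt (s := Set.Icc (2 * (j : ℝ) * r) (2 * ((j : ℝ) + 1) * r))).congr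
    (fun x hx ↦ geodesicProfile_sq hr hj hx) (geodesicProfile_sq hr hj hc)
  have heq := (uniqueDiffOn_Icc (by linarith) c hc).eq_deriv _ hsq hpoly
  have hlin : c - (2 * (j : ℝ) + 1) * r = 0 := by
    simpa [hzero] using heq
  rw [hlin] at hc'
  nlinarith

/-- The geodesic profile function `φ` is not differentiable at
the points `x = 2ir` for `0 ≤ i ≤ N`: the geodesic fails to be differentiable
at each simple contact of two consecutive balls. -/
theorem geodesicProfile_not_differentiable_at_contacts (r : ℝ) (hr : 0 < r)
    (N : ℕ) (hN : 1 ≤ N) :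
    ∀ i : ℕ, i ≤ N → ¬ DifferentiableAt ℝ (geodesicProfile r N) (2 * (i : ℝ) * r) := by
  intro i hi
  rcases hi.lt_or_eq with h | rfl
  · exact not_differentiableAt_geodesicProfile hr h ⟨le_rfl, by linarith⟩ (by ring)
  · obtain ⟨j, rfl⟩ := Nat.exists_eq_add_of_le' hN
    refine not_differentiableAt_geodesicProfile hr j.lt_succ_self ⟨?_, ?_⟩ ?_ <;> push_cast
    · linarith
    · exact le_rfl
    · ring
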